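/- There exists a constant C > 0 such that for any n×N random matrix A with i.i.d. standard Gaussian entries and any sparsity level s with s/N < 1/5, E(σ_min^s(A)) ≥ √(n − 1/2) − √s·T − C/√(log(N/s)), where T = √(E(Y | Y > t)) with Y a χ²₁ random variable and t defined by P(Y > t) = s/N. -/

import Mathlib

open MeasureTheory ProbabilityTheory

/-- Law of an `n × N` matrix with i.i.d. standard Gaussian entries. -/
noncomputable def gaussianMatrixMeasure (n N : ℕ) : Measure (Fin n → Fin N → ℝ) :=
  Measure.pi fun _ => Measure.pi fun _ => gaussianReal 0 1

/-- The χ²₁ distribution: law of the square of a standard Gaussian. -/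
noncomputable def chiSq1 : Measure ℝ := (gaussianReal 0 1).map (· ^ 2)

/-- Conditional expectation `E(Y | Y > t)` for `Y ~ chiSq1`. -/
noncomputable def condExpGt (t : ℝ) : ℝ :=
  (∫ y in Set.Ioi t, y ∂chiSq1) / (chiSq1 (Set.Ioi t)).toReal

/-- The set Ψ_s of `s`-sparse unit vectors in `ℝ^N`. -/
def sparseUnitVecs (N s : ℕ) : Set (Fin N → ℝ) :=
  {x | (∑ j, x j ^ 2) = 1 ∧ (Finset.univ.filter fun j => x j ≠ 0).card ≤ s}

/-- `‖A x‖²` for `A : ℝ^{n×N}`, `x : ℝ^N`. -/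
noncomputable def normSqMulVec {n N : ℕ} (A : Fin n → Fin N → ℝ) (x : Fin N → ℝ) : ℝ :=
  ∑ i, (∑ j, A i j * x j) ^ 2

/-- `σ_min^s(A) = inf_{x ∈ Ψ_s} ‖Ax‖`. -/
noncomputable def sigmaMin (n N s : ℕ) (A : Fin n → Fin N → ℝ) : ℝ :=
  sInf ((fun x => Real.sqrt (normSqMulVec A x)) '' sparseUnitVecs N s)

theorem integral_id_mul_gaussianReal_eq_integral_deriv {f f' : ℝ → ℝ} {B B' : ℝ}
    (hf : ∀ x, HasDerivAt f (f' x) x) (hf'c : Measurable f')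
    (hB : ∀ x, |f x| ≤ B) (hB' : ∀ x, |f' x| ≤ B') :
    ∫ x, x * f x ∂gaussianReal 0 1 = ∫ x, f' x ∂gaussianReal 0 1 := by
  have hfc : Continuous f := continuous_iff_continuousAt.2 fun x => (hf x).continuousAt
  have hv : ∀ x, HasDerivAt (fun x => -gaussianPDFReal 0 1 x) (x * gaussianPDFReal 0 1 x) x := by
    intro x
    have h2 : HasDerivAt (fun x : ℝ => -(x - 0) ^ 2 / (2 * ((1 : NNReal) : ℝ))) (-x) x := by
      have := (((hasDerivAt_id x).sub_const 0).pow 2).neg.div_const (2 * ((1 : NNReal) : ℝ))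
      convert! this using 1
      simp; ring
    have h3 := (h2.exp.const_mul (√(2 * Real.pi * ((1 : NNReal) : ℝ)))⁻¹).neg
    convert! h3 using 1
    simp only [gaussianPDFReal]
    ring
  have hint1 : Integrable (fun x => x * gaussianPDFReal 0 1 x) := by
    have h := (memLp_id_gaussianReal (μ := 0) (v := 1) 1).integrable le_rfl
    rw [gaussianReal_of_var_ne_zero _ one_ne_zero, gaussianPDF_def,
      integrable_withDensity_iff_integrable_smul₀'] at h
    · refine h.congr (ae_of_all _ fun x => ?_)
      simp [ENNReal.toReal_ofReal (gaussianPDFReal_nonneg 0 1 x), mul_comm]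
    · exact (measurable_gaussianPDF 0 1).aemeasurable
    · exact ae_of_all _ fun x => ENNReal.ofReal_lt_top
  have hint0 := integrable_gaussianPDFReal 0 1
  have key := integral_mul_deriv_eq_deriv_mul_of_integrable (u := f) (u' := f')
    (v := fun x => -gaussianPDFReal 0 1 x) (v' := fun x => x * gaussianPDFReal 0 1 x)
    (fun x _ => hf x) (fun x _ => hv x)
    (hint1.bdd_mul hfc.aestronglyMeasurable (ae_of_all _ hB))
    (hint0.neg.bdd_mul hf'c.aestronglyMeasurable (ae_of_all _ hB'))
    (hint0.neg.bdd_mul hfc.aestronglyMeasurable (ae_of_all _ hB))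
  rw [integral_gaussianReal_eq_integral_smul one_ne_zero,
    integral_gaussianReal_eq_integral_smul one_ne_zero]
  calc _ = ∫ x, f x * (x * gaussianPDFReal 0 1 x) := by
        congr 1; ext x; simp only [smul_eq_mul]; ring
    _ = _ := by
        rw [key, ← integral_neg]; congr 1; ext x; simp only [smul_eq_mul]; ring

theorem MeasureTheory.MeasurePreserving.integral_comp_of_aestronglyMeasurable
    {α β : Type*} [MeasurableSpace α] [MeasurableSpace β] {μ : Measure α} {ν : Measure β}
    {f : α → β} (hf : MeasurePreserving f μ ν) {g : β → ℝ} (hg : AEStronglyMeasurable g ν) :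
    ∫ x, g (f x) ∂μ = ∫ y, g y ∂ν := by
  rw [← hf.map_eq, integral_map hf.aemeasurable (hf.map_eq.symm ▸ hg)]

theorem measurePreserving_update {ι : Type*} [Fintype ι] [DecidableEq ι] {α : ι → Type*}
    [∀ i, MeasurableSpace (α i)] (μ : ∀ i, Measure (α i)) [∀ i, IsProbabilityMeasure (μ i)]
    (i : ι) :
    MeasurePreserving (fun p : α i × (∀ j, α j) => Function.update p.2 i p.1)
      ((μ i).prod (Measure.pi μ)) (Measure.pi μ) := by
  have hm : Measurable (fun p : α i × (∀ j, α j) => Function.update p.2 i p.1) := by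
    refine measurable_pi_lambda _ fun j => ?_
    by_cases h : j = i
    · subst h; simpa using measurable_fst
    · simp only [Function.update_of_ne h]; fun_prop
  refine ⟨hm, (Measure.pi_eq fun s hs => ?_).symm⟩
  rw [Measure.map_apply hm (MeasurableSet.univ_pi hs)]
  have : (fun p : α i × (∀ j, α j) => Function.update p.2 i p.1) ⁻¹' Set.univ.pi s
      = s i ×ˢ Set.univ.pi (Function.update s i Set.univ) := by
    ext ⟨r, ω⟩
    simp only [Set.mem_preimage, Set.mem_pi, Set.mem_univ, true_imp_iff, Set.mem_prod]
    constructor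
    · intro h
      refine ⟨by simpa using h i, fun j => ?_⟩
      by_cases hj : j = i
      · subst hj; simp
      · simpa [hj] using h j
    · rintro ⟨h1, h2⟩ j
      by_cases hj : j = i
      · subst hj; simpa using h1
      · simpa [hj] using h2 j
  rw [this, Measure.prod_prod, Measure.pi_pi, ← Finset.mul_prod_erase _ _ (Finset.mem_univ i),
    ← Finset.mul_prod_erase _ (fun j => (μ j) (s j)) (Finset.mem_univ i)]
  simp only [Function.update_self, measure_univ, one_mul]
  congr 1
  refine Finset.prod_congr rfl fun j hj => ?_
  rw [Function.update_of_ne (Finset.ne_of_mem_erase hj)]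

/-- The standard Gaussian measure on `ι → ℝ`. -/
noncomputable abbrev stdGaussianPi (ι : Type*) [Fintype ι] : Measure (ι → ℝ) :=
  Measure.pi fun _ => gaussianReal 0 1

theorem integrable_eval_stdGaussianPi {ι : Type*} [Fintype ι] (i : ι) :
    Integrable (fun ω : ι → ℝ => ω i) (stdGaussianPi ι) :=
  (measurePreserving_eval (fun _ : ι => gaussianReal 0 1) i).integrable_comp_of_integrable
    (memLp_one_iff_integrable.1 (memLp_id_gaussianReal 1))

theorem integral_eval_stdGaussianPi {ι : Type*} [Fintype ι] (i : ι) :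
    ∫ ω, ω i ∂stdGaussianPi ι = 0 :=
  ((measurePreserving_eval (fun _ : ι => gaussianReal 0 1) i).integral_comp_of_aestronglyMeasurable
    (g := fun x => x) aestronglyMeasurable_id).trans integral_id_gaussianReal

theorem integral_eval_mul_stdGaussianPi {ι : Type*} [Fintype ι] [DecidableEq ι] (i : ι)
    {f f' : (ι → ℝ) → ℝ} {B B' : ℝ}
    (hf : ∀ ω, HasDerivAt (fun r => f (Function.update ω i r)) (f' ω) (ω i))
    (hfm : Measurable f) (hf'm : Measurable f')
    (hB : ∀ x, |f x| ≤ B) (hB' : ∀ x, |f' x| ≤ B') :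
    ∫ ω, ω i * f ω ∂stdGaussianPi ι = ∫ ω, f' ω ∂stdGaussianPi ι := by
  have hmp := measurePreserving_update (fun _ : ι => gaussianReal 0 1) i
  have hi1 : Integrable (fun ω : ι → ℝ => ω i * f ω) (stdGaussianPi ι) :=
    (integrable_eval_stdGaussianPi i).mul_bdd hfm.aestronglyMeasurable (ae_of_all _ hB)
  have hi2 : Integrable f' (stdGaussianPi ι) :=
    Integrable.of_bound hf'm.aestronglyMeasurable B' (ae_of_all _ hB')
  rw [← hmp.integral_comp_of_aestronglyMeasurable hi1.aestronglyMeasurable,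
    ← hmp.integral_comp_of_aestronglyMeasurable hi2.aestronglyMeasurable,
    integral_prod_symm (fun p : ℝ × (ι → ℝ) => Function.update p.2 i p.1 i *
      f (Function.update p.2 i p.1)) (hmp.integrable_comp_of_integrable hi1),
    integral_prod_symm (fun p : ℝ × (ι → ℝ) => f' (Function.update p.2 i p.1))
      (hmp.integrable_comp_of_integrable hi2)]
  congr 1
  ext ω
  simp only [Function.update_self]
  refine integral_id_mul_gaussianReal_eq_integral_deriv (B := B) (B' := B') (fun r => ?_)
    ?_ (fun _ => hB _) (fun _ => hB' _)
  · simpa using hf (Function.update ω i r)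
  · exact hf'm.comp (measurable_update ω)

theorem integral_comp_linear_le_of_covariance {ι I : Type*} [Fintype ι] [Fintype I]
    (L K : I → ι → ℝ) (hLK : ∀ a b, ∑ m, L a m * K b m = 0)
    {F : (I → ℝ) → ℝ} {F' : I → (I → ℝ) → ℝ} {F'' : I → I → (I → ℝ) → ℝ} {B B' : ℝ}
    (hF : ∀ z, HasFDerivAt F (∑ a, F' a z • ContinuousLinearMap.proj (R := ℝ) (φ := fun _ => ℝ) a) z)
    (hF' : ∀ a z, HasFDerivAt (F' a)
      (∑ b, F'' a b z • ContinuousLinearMap.proj (R := ℝ) (φ := fun _ => ℝ) b) z)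
    (hF''m : ∀ a b, Measurable (F'' a b))
    (hB : ∀ a z, |F' a z| ≤ B) (hB' : ∀ a b z, |F'' a b z| ≤ B')
    (hsign : ∀ z, 0 ≤ ∑ a, ∑ b, (∑ m, (L a m * L b m - K a m * K b m)) * F'' a b z) :
    ∫ ω, F (fun a => ∑ m, K a m * ω m) ∂stdGaussianPi ι ≤
      ∫ ω, F (fun a => ∑ m, L a m * ω m) ∂stdGaussianPi ι := by
  classical
  set μ := stdGaussianPi ι
  let M : ℝ → I → ι → ℝ := fun θ a m => Real.cos θ * L a m + Real.sin θ * K a m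
  let M' : ℝ → I → ι → ℝ := fun θ a m => -Real.sin θ * L a m + Real.cos θ * K a m
  let Z : ℝ → (ι → ℝ) → I → ℝ := fun θ ω a => ∑ m, M θ a m * ω m
  have hFc : Continuous F := continuous_iff_continuousAt.2 fun z => (hF z).continuousAt
  have hF'c : ∀ a, Continuous (F' a) := fun a =>
    continuous_iff_continuousAt.2 fun z => (hF' a z).continuousAt
  have hZc : ∀ θ, Continuous (Z θ) := fun θ => by fun_prop
  have hM' : ∀ θ a m, |M' θ a m| ≤ |L a m| + |K a m| := by
    intro θ a m
    refine (abs_add_le _ _).trans ?_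
    rw [abs_mul, abs_mul, abs_neg]
    have h1 := Real.abs_sin_le_one θ
    have h2 := Real.abs_cos_le_one θ
    exact add_le_add (mul_le_of_le_one_left (abs_nonneg _) h1)
      (mul_le_of_le_one_left (abs_nonneg _) h2)
  have hZd : ∀ θ ω, HasDerivAt (fun θ => Z θ ω) (fun a => ∑ m, M' θ a m * ω m) θ := by
    intro θ ω
    refine hasDerivAt_pi.2 fun a => HasDerivAt.fun_sum fun m _ => ?_
    exact (((Real.hasDerivAt_cos θ).mul_const _).add
      ((Real.hasDerivAt_sin θ).mul_const _)).mul_const _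
  have hFZ : ∀ θ ω, HasDerivAt (fun θ => F (Z θ ω))
      (∑ a, F' a (Z θ ω) * ∑ m, M' θ a m * ω m) θ := by
    intro θ ω
    have := (hF (Z θ ω)).comp_hasDerivAt θ (hZd θ ω)
    convert! this using 1
    simp
  let bd : (ι → ℝ) → ℝ := fun ω => ∑ a, B * ∑ m, (|L a m| + |K a m|) * |ω m|
  have hbd : Integrable bd μ := by
    refine integrable_finsetSum _ fun a _ => Integrable.const_mul ?_ _
    exact integrable_finsetSum _ fun m _ => (integrable_eval_stdGaussianPi m).abs.const_mul _
  have hle : ∀ θ ω, ‖∑ a, F' a (Z θ ω) * ∑ m, M' θ a m * ω m‖ ≤ bd ω := by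
    intro θ ω
    rw [Real.norm_eq_abs]
    refine (Finset.abs_sum_le_sum_abs _ _).trans (Finset.sum_le_sum fun a _ => ?_)
    rw [abs_mul]
    refine mul_le_mul (hB a _) ((Finset.abs_sum_le_sum_abs _ _).trans
      (Finset.sum_le_sum fun m _ => ?_)) (abs_nonneg _) ((abs_nonneg _).trans (hB a 0))
    rw [abs_mul]
    exact mul_le_mul_of_nonneg_right (hM' θ a m) (abs_nonneg _)
  have hint : ∀ θ, Integrable (fun ω => F (Z θ ω)) μ := by
    have hl : ∀ z, |F z - F 0| ≤ ∑ a, B * |z a| := by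
      intro z
      have hd : ∀ r : ℝ, HasDerivAt (fun r : ℝ => F (r • z)) (∑ a, F' a (r • z) * z a) r := by
        intro r
        have := (hF (r • z)).comp_hasDerivAt r ((hasDerivAt_id r).smul_const z)
        convert! this using 1
        simp
      have := convex_univ.norm_image_sub_le_of_norm_hasDerivWithin_le
        (f := fun r : ℝ => F (r • z)) (C := ∑ a, B * |z a|) (x := 0) (y := 1)
        (fun x _ => (hd x).hasDerivWithinAt) (fun x _ => ?_) trivial trivial
      · simpa using this
      · rw [Real.norm_eq_abs]
        refine (Finset.abs_sum_le_sum_abs _ _).trans (Finset.sum_le_sum fun a _ => ?_)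
        rw [abs_mul]
        exact mul_le_mul_of_nonneg_right (hB a _) (abs_nonneg _)
    intro θ
    have h1 : Integrable (fun ω => F (Z θ ω) - F 0) μ := by
      refine Integrable.mono' (g := fun ω => ∑ a, B * |Z θ ω a|) ?_
        ((hFc.comp (hZc θ)).sub continuous_const).aestronglyMeasurable
        (ae_of_all _ fun ω => hl _)
      refine integrable_finsetSum _ fun a _ => Integrable.const_mul (Integrable.abs ?_) _
      exact integrable_finsetSum _ fun m _ => (integrable_eval_stdGaussianPi m).const_mul _
    exact (h1.add (integrable_const (F 0))).congr (ae_of_all _ fun ω => by simp)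
  have hderiv : ∀ θ, HasDerivAt (fun θ => ∫ ω, F (Z θ ω) ∂μ)
      (∫ ω, ∑ a, F' a (Z θ ω) * ∑ m, M' θ a m * ω m ∂μ) θ := by
    intro θ
    refine (hasDerivAt_integral_of_dominated_loc_of_deriv_le (bound := bd) Filter.univ_mem
      (Filter.Eventually.of_forall fun θ => (hint θ).aestronglyMeasurable) (hint θ) ?_
      (ae_of_all _ fun ω θ _ => hle θ ω) hbd (ae_of_all _ fun ω θ _ => hFZ θ ω)).2
    refine Continuous.aestronglyMeasurable ?_
    exact continuous_finsetSum _ fun a _ => ((hF'c a).comp (hZc θ)).mul (by fun_prop)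
  have hval : ∀ θ, ∫ ω, ∑ a, F' a (Z θ ω) * ∑ m, M' θ a m * ω m ∂μ =
      -(Real.sin θ * Real.cos θ) * ∫ ω, ∑ a, ∑ b,
        (∑ m, (L a m * L b m - K a m * K b m)) * F'' a b (Z θ ω) ∂μ := by
    intro θ
    have i1 : ∀ a m, Integrable (fun ω => ω m * F' a (Z θ ω)) μ := fun a m =>
      (integrable_eval_stdGaussianPi m).mul_bdd
        ((hF'c a).comp (hZc θ)).aestronglyMeasurable (ae_of_all _ fun ω => hB a _)
    have i2 : ∀ a b, Integrable (fun ω => F'' a b (Z θ ω)) μ := fun a b =>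
      Integrable.of_bound ((hF''m a b).comp (hZc θ).measurable).aestronglyMeasurable B'
        (ae_of_all _ fun ω => hB' a b _)
    have stein : ∀ a m, ∫ ω, ω m * F' a (Z θ ω) ∂μ =
        ∑ b, M θ b m * ∫ ω, F'' a b (Z θ ω) ∂μ := by
      intro a m
      have hupd : ∀ ω, HasDerivAt (fun r => Z θ (Function.update ω m r)) (fun b => M θ b m)
          (ω m) := by
        intro ω
        refine hasDerivAt_pi.2 fun b => ?_
        have : HasDerivAt (fun r => ∑ k, M θ b k * Function.update ω m r k)
            (∑ k, M θ b k * (Pi.single m 1 : ι → ℝ) k) (ω m) := by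
          refine HasDerivAt.fun_sum fun k _ => HasDerivAt.const_mul _ ?_
          exact hasDerivAt_pi.1 (hasDerivAt_update ω m (ω m)) k
        simpa [Pi.single_apply] using this
      have hst := integral_eval_mul_stdGaussianPi m (f := fun ω => F' a (Z θ ω))
        (f' := fun ω => ∑ b, M θ b m * F'' a b (Z θ ω)) (B := B)
        (B' := ∑ b, |M θ b m| * B') (fun ω => ?_)
        ((hF'c a).comp (hZc θ)).measurable ?_ (fun ω => hB a _) (fun ω => ?_)
      · rw [hst, integral_finsetSum _ fun b _ => (i2 a b).const_mul _]
        simp only [integral_const_mul]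
      · have h := (hF' a (Z θ (Function.update ω m (ω m)))).comp_hasDerivAt (ω m) (hupd ω)
        convert! h using 1
        simp [mul_comm]
      · exact Finset.measurable_sum _ fun b _ =>
          ((hF''m a b).comp (hZc θ).measurable).const_mul _
      · refine (Finset.abs_sum_le_sum_abs _ _).trans (Finset.sum_le_sum fun b _ => ?_)
        rw [abs_mul]
        exact mul_le_mul_of_nonneg_left (hB' a b _) (abs_nonneg _)
    have hcov : ∀ a b, ∑ m, M' θ a m * M θ b m =
        -(Real.sin θ * Real.cos θ) * ∑ m, (L a m * L b m - K a m * K b m) := by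
      intro a b
      have h1 := hLK a b
      have h2 := hLK b a
      calc ∑ m, M' θ a m * M θ b m = -(Real.sin θ * Real.cos θ) *
            ∑ m, (L a m * L b m - K a m * K b m) - Real.sin θ ^ 2 * ∑ m, L a m * K b m
            + Real.cos θ ^ 2 * ∑ m, L b m * K a m := by
            simp only [Finset.mul_sum, ← Finset.sum_sub_distrib, ← Finset.sum_add_distrib, M, M']
            exact Finset.sum_congr rfl fun m _ => by ring
        _ = _ := by rw [h1, h2]; ring
    calc ∫ ω, ∑ a, F' a (Z θ ω) * ∑ m, M' θ a m * ω m ∂μ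
        = ∫ ω, ∑ a, ∑ m, M' θ a m * (ω m * F' a (Z θ ω)) ∂μ := by
          congr 1; ext ω; simp only [Finset.mul_sum]
          exact Finset.sum_congr rfl fun a _ => Finset.sum_congr rfl fun m _ => by ring
      _ = ∑ a, ∑ m, M' θ a m * ∑ b, M θ b m * ∫ ω, F'' a b (Z θ ω) ∂μ := by
          rw [integral_finsetSum _ fun a _ => integrable_finsetSum _ fun m _ =>
            (i1 a m).const_mul _]
          refine Finset.sum_congr rfl fun a _ => ?_
          rw [integral_finsetSum _ fun m _ => (i1 a m).const_mul _]
          exact Finset.sum_congr rfl fun m _ => by rw [integral_const_mul, stein]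
      _ = ∑ a, ∑ b, (∑ m, M' θ a m * M θ b m) * ∫ ω, F'' a b (Z θ ω) ∂μ := by
          refine Finset.sum_congr rfl fun a _ => ?_
          simp only [Finset.mul_sum, Finset.sum_mul]
          rw [Finset.sum_comm]
          exact Finset.sum_congr rfl fun b _ => Finset.sum_congr rfl fun m _ => by ring
      _ = _ := by
          rw [integral_finsetSum _ fun a _ => integrable_finsetSum _ fun b _ =>
            (i2 a b).const_mul _, Finset.mul_sum]
          refine Finset.sum_congr rfl fun a _ => ?_
          rw [integral_finsetSum _ fun b _ => (i2 a b).const_mul _, Finset.mul_sum]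
          refine Finset.sum_congr rfl fun b _ => ?_
          rw [hcov, integral_const_mul]
          ring
  have hanti : AntitoneOn (fun θ => ∫ ω, F (Z θ ω) ∂μ) (Set.Icc 0 (Real.pi / 2)) := by
    refine antitoneOn_of_deriv_nonpos (convex_Icc _ _)
      (fun θ _ => (hderiv θ).continuousAt.continuousWithinAt)
      (fun θ _ => (hderiv θ).differentiableAt.differentiableWithinAt) fun θ hθ => ?_
    rw [interior_Icc] at hθ
    rw [(hderiv θ).deriv, hval θ, neg_mul]
    have h1 := Real.sin_nonneg_of_nonneg_of_le_pi hθ.1.le (by linarith [hθ.2, Real.pi_pos])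
    have h2 := Real.cos_nonneg_of_neg_pi_div_two_le_of_le (by linarith [hθ.1, Real.pi_pos]) hθ.2.le
    exact neg_nonpos.2 (mul_nonneg (mul_nonneg h1 h2) (integral_nonneg fun ω => hsign _))
  have := hanti (Set.left_mem_Icc.2 (by positivity)) (Set.right_mem_Icc.2 (by positivity))
    (by positivity)
  simpa [Z, M] using this

/-- The soft minimum with inverse temperature `α`. -/
noncomputable def softmin {S : Type*} [Fintype S] (α : ℝ) (v : S → ℝ) : ℝ :=
  -α⁻¹ * Real.log (∑ x, Real.exp (-α * v x))

theorem softmin_le {S : Type*} [Fintype S] {α : ℝ} (hα : 0 < α) (v : S → ℝ) (x : S) :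
    softmin α v ≤ v x := by
  have h1 : Real.exp (-α * v x) ≤ ∑ x, Real.exp (-α * v x) :=
    Finset.single_le_sum (f := fun x => Real.exp (-α * v x)) (fun _ _ => (Real.exp_pos _).le)
      (Finset.mem_univ x)
  have h2 := (Real.le_log_iff_exp_le ((Real.exp_pos _).trans_le h1)).2 h1
  have h3 : α * softmin α v = -Real.log (∑ x, Real.exp (-α * v x)) := by
    unfold softmin; field_simp
  nlinarith

theorem le_softmin {S : Type*} [Fintype S] [Nonempty S] {α : ℝ} (hα : 0 < α) (v : S → ℝ) {c : ℝ}
    (h : ∀ x, c ≤ v x) : c - Real.log (Fintype.card S) / α ≤ softmin α v := by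
  have h1 : ∑ x, Real.exp (-α * v x) ≤ Fintype.card S * Real.exp (-α * c) := by
    rw [← nsmul_eq_mul]
    refine Finset.sum_le_card_nsmul _ _ _ fun x _ => Real.exp_le_exp.2 ?_
    nlinarith [h x]
  have hpos : 0 < ∑ x, Real.exp (-α * v x) :=
    Finset.sum_pos (fun _ _ => Real.exp_pos _) Finset.univ_nonempty
  have h2 := Real.log_le_log hpos h1
  have hc : (Fintype.card S : ℝ) ≠ 0 := by simp
  rw [Real.log_mul hc (Real.exp_pos _).ne', Real.log_exp] at h2
  unfold softmin
  have h3 : c - Real.log (Fintype.card S) / α =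
      -α⁻¹ * (Real.log (Fintype.card S) + -α * c) := by field_simp; ring
  rw [h3]
  exact mul_le_mul_of_nonpos_left h2 (by simpa using hα.le)

theorem integral_softmin_comp_linear_le {S κ ι : Type*} [Fintype S] [Nonempty S] [Fintype κ]
    [Fintype ι] {α D : ℝ} (hα : 0 < α) (L K : S × κ → ι → ℝ)
    (hLK : ∀ a b, ∑ i, L a i * K b i = 0)
    {m : (κ → ℝ) → ℝ} {dm : κ → (κ → ℝ) → ℝ} {ddm : κ → κ → (κ → ℝ) → ℝ}
    (hm : ∀ z, HasFDerivAt m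
      (∑ k, dm k z • ContinuousLinearMap.proj (R := ℝ) (φ := fun _ => ℝ) k) z)
    (hdm : ∀ k z, HasFDerivAt (dm k)
      (∑ l, ddm k l z • ContinuousLinearMap.proj (R := ℝ) (φ := fun _ => ℝ) l) z)
    (hddm : ∀ k l, Measurable (ddm k l))
    (hdm1 : ∀ k z, |dm k z| ≤ 1) (hddm1 : ∀ k l z, |ddm k l z| ≤ D)
    (hdiag : ∀ x k l, ∑ i, (L (x, k) i * L (x, l) i - K (x, k) i * K (x, l) i) = 0)
    (hoff : ∀ x y z w, 0 ≤ ∑ k, ∑ l,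
      (∑ i, (L (x, k) i * L (y, l) i - K (x, k) i * K (y, l) i)) * (dm k z * dm l w)) :
    ∫ ω, softmin α (fun x => m fun k => ∑ i, K (x, k) i * ω i) ∂stdGaussianPi ι ≤
      ∫ ω, softmin α (fun x => m fun k => ∑ i, L (x, k) i * ω i) ∂stdGaussianPi ι := by
  classical
  let r : S → (S × κ → ℝ) → κ → ℝ := fun x z k => z (x, k)
  let P : S × κ → ((S × κ → ℝ) →L[ℝ] ℝ) :=
    fun a => ContinuousLinearMap.proj (R := ℝ) (φ := fun _ => ℝ) a
  let E : S → (S × κ → ℝ) → ℝ := fun x z => Real.exp (-α * m (r x z))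
  let W : (S × κ → ℝ) → ℝ := fun z => ∑ x, E x z
  let p : S → (S × κ → ℝ) → ℝ := fun x z => E x z / W z
  have hE : ∀ x z, 0 < E x z := fun x z => Real.exp_pos _
  have hW : ∀ z, 0 < W z := fun z => Finset.sum_pos (fun x _ => hE x z) Finset.univ_nonempty
  have hp0 : ∀ x z, 0 ≤ p x z := fun x z => (div_pos (hE x z) (hW z)).le
  have hp1 : ∀ x z, p x z ≤ 1 := fun x z => (div_le_one (hW z)).2
    (Finset.single_le_sum (f := fun x => E x z) (fun x _ => (hE x z).le) (Finset.mem_univ x))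
  have hcomp : ∀ (f : (κ → ℝ) → ℝ) (f' : κ → ℝ) (x : S) (z : S × κ → ℝ),
      HasFDerivAt f (∑ k, f' k • ContinuousLinearMap.proj (R := ℝ) (φ := fun _ => ℝ) k) (r x z) →
      HasFDerivAt (fun z => f (r x z)) (∑ k, f' k • P (x, k)) z := by
    intro f f' x z hf
    have h1 : HasFDerivAt (r x) (ContinuousLinearMap.pi fun k => P (x, k)) z :=
      hasFDerivAt_pi.2 fun k => (P (x, k)).hasFDerivAt
    convert! hf.comp z h1 using 1
    ext v
    simp [P]
  have hEd : ∀ x z, HasFDerivAt (E x) ((-α * E x z) • ∑ k, dm k (r x z) • P (x, k)) z := by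
    intro x z
    have h := ((hcomp m _ x z (hm _)).const_mul (-α)).exp
    convert! h using 1
    ext v
    simp [E]
    ring
  have hWd : ∀ z, HasFDerivAt W (∑ x, (-α * E x z) • ∑ k, dm k (r x z) • P (x, k)) z :=
    fun z => HasFDerivAt.fun_sum fun x _ => hEd x z
  have hpd : ∀ x z, HasFDerivAt (p x) ((-α * p x z) • (∑ k, dm k (r x z) • P (x, k)) +
      (α * p x z) • ∑ y, p y z • ∑ k, dm k (r y z) • P (y, k)) z := by
    intro x z
    have h := (hEd x z).mul ((hasDerivAt_inv (hW z).ne').comp_hasFDerivAt z (hWd z))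
    convert! h using 1
    ext v
    have hw := (hW z).ne'
    simp only [p, add_apply, smul_apply, sum_apply,
      smul_eq_mul, Function.comp]
    have e1 : ∑ y, E y z / W z * ∑ k, dm k (r y z) * (P (y, k)) v =
        (W z)⁻¹ * ∑ y, E y z * ∑ k, dm k (r y z) * (P (y, k)) v := by
      rw [Finset.mul_sum]; exact Finset.sum_congr rfl fun y _ => by ring
    have e2 : ∑ y, -α * E y z * ∑ k, dm k (r y z) * (P (y, k)) v =
        -α * ∑ y, E y z * ∑ k, dm k (r y z) * (P (y, k)) v := by
      rw [Finset.mul_sum]; exact Finset.sum_congr rfl fun y _ => by ring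
    rw [e1, e2]
    field_simp
    ring
  refine integral_comp_linear_le_of_covariance L K hLK
    (F := fun z => softmin α fun x => m (r x z))
    (F' := fun a z => p a.1 z * dm a.2 (r a.1 z))
    (F'' := fun a b z => (if a.1 = b.1 then p a.1 z * ddm a.2 b.2 (r a.1 z)
        - α * p a.1 z * (dm a.2 (r a.1 z) * dm b.2 (r b.1 z)) else 0)
      + α * p a.1 z * p b.1 z * (dm a.2 (r a.1 z) * dm b.2 (r b.1 z)))
    (B := 1) (B' := D + α + α) ?_ ?_ ?_ ?_ ?_ ?_
  · intro z
    have h := ((hWd z).log (hW z).ne').const_mul (-α⁻¹)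
    convert! h using 1
    ext v
    simp only [p, smul_apply, sum_apply, smul_eq_mul, Fintype.sum_prod_type,
      Finset.mul_sum]
    refine Finset.sum_congr rfl fun x _ => Finset.sum_congr rfl fun k _ => ?_
    have hw := (hW z).ne'
    field_simp
    rfl
  · rintro ⟨x, k⟩ z
    have h := (hpd x z).mul (hcomp (dm k) _ x z (hdm k _))
    convert! h using 1
    ext v
    simp only [add_apply, smul_apply, sum_apply,
      smul_eq_mul, Fintype.sum_prod_type, add_mul, ite_mul, zero_mul, Finset.sum_add_distrib]
    have e : ∀ y, (∑ l, if x = y then (p x z * ddm k l (r x z) - α * p x z *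
          (dm k (r x z) * dm l (r y z))) * (P (y, l)) v else 0) =
        if x = y then ∑ l, (p x z * ddm k l (r x z) - α * p x z *
          (dm k (r x z) * dm l (r y z))) * (P (y, l)) v else 0 := by
      intro y; split_ifs <;> simp
    have e3 : ∑ l, (p x z * ddm k l (r x z) - α * p x z *
          (dm k (r x z) * dm l (r x z))) * (P (x, l)) v =
        p x z * ∑ l, ddm k l (r x z) * (P (x, l)) v -
          α * p x z * dm k (r x z) * ∑ l, dm l (r x z) * (P (x, l)) v := by
      simp only [Finset.mul_sum, ← Finset.sum_sub_distrib]
      exact Finset.sum_congr rfl fun l _ => by ring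
    have e4 : ∑ y, ∑ l, α * p x z * p y z * (dm k (r x z) * dm l (r y z)) * (P (y, l)) v =
        α * p x z * dm k (r x z) * ∑ y, p y z * ∑ l, dm l (r y z) * (P (y, l)) v := by
      simp only [Finset.mul_sum]
      exact Finset.sum_congr rfl fun y _ => Finset.sum_congr rfl fun l _ => by ring
    have e5 : ∑ y, (∑ l, if x = y then (p x z * ddm k l (r x z) - α * p x z *
          (dm k (r x z) * dm l (r y z))) * (P (y, l)) v else 0) =
        p x z * ∑ l, ddm k l (r x z) * (P (x, l)) v -
          α * p x z * dm k (r x z) * ∑ l, dm l (r x z) * (P (x, l)) v := by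
      simp only [e]
      rw [Finset.sum_ite_eq Finset.univ x]
      simpa using e3
    refine (congrArg₂ (· + ·) e5 e4).trans ?_
    ring
  · rintro ⟨x, k⟩ ⟨y, l⟩
    have hr : ∀ x, Measurable (r x) := fun x => by fun_prop
    have hdmm : ∀ k x, Measurable fun z => dm k (r x z) := fun k x =>
      (continuous_iff_continuousAt.2 fun z => (hdm k z).continuousAt).measurable.comp (hr x)
    have hpm : ∀ x, Measurable (p x) := fun x =>
      (continuous_iff_continuousAt.2 fun z => (hpd x z).continuousAt).measurable
    have hddmm : ∀ k l x, Measurable fun z => ddm k l (r x z) := fun k l x =>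
      (hddm k l).comp (hr x)
    refine Measurable.add ?_ (((hpm x).const_mul α |>.mul (hpm y)).mul ((hdmm k x).mul (hdmm l y)))
    by_cases hxy : x = y
    · simp only [hxy, if_true]
      exact ((hpm y).mul (hddmm k l y)).sub
        (((hpm y).const_mul α).mul ((hdmm k y).mul (hdmm l y)))
    · simp [hxy]
  · intro a z
    rw [abs_mul, abs_of_nonneg (hp0 _ _)]
    exact mul_le_one₀ (hp1 _ _) (abs_nonneg _) (hdm1 _ _)
  · rintro ⟨x, k⟩ ⟨y, l⟩ z
    have hD : 0 ≤ D := (abs_nonneg _).trans (hddm1 k l 0)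
    have hdd : |dm k (r x z) * dm l (r y z)| ≤ 1 := by
      rw [abs_mul]; exact mul_le_one₀ (hdm1 _ _) (abs_nonneg _) (hdm1 _ _)
    have hap : ∀ x, |α * p x z| ≤ α := fun x => by
      rw [abs_mul, abs_of_pos hα, abs_of_nonneg (hp0 _ _)]
      exact mul_le_of_le_one_right hα.le (hp1 _ _)
    have h1 : |p x z * ddm k l (r x z)| ≤ D := by
      rw [abs_mul, abs_of_nonneg (hp0 _ _)]
      exact (mul_le_of_le_one_left (abs_nonneg _) (hp1 _ _)).trans (hddm1 _ _ _)
    have h2 : |α * p x z * (dm k (r x z) * dm l (r y z))| ≤ α := by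
      rw [abs_mul]
      exact (mul_le_of_le_one_right (abs_nonneg _) hdd).trans (hap x)
    have h3 : |α * p x z * p y z * (dm k (r x z) * dm l (r y z))| ≤ α := by
      rw [abs_mul, abs_mul _ (p y z), abs_of_nonneg (hp0 y z)]
      exact (mul_le_of_le_one_right (mul_nonneg (abs_nonneg _) (hp0 _ _)) hdd).trans
        ((mul_le_of_le_one_right (abs_nonneg _) (hp1 _ _)).trans (hap x))
    refine (abs_add_le _ _).trans (add_le_add ?_ h3)
    dsimp only
    split_ifs
    · exact (abs_sub _ _).trans (add_le_add h1 h2)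
    · simp; positivity
  · intro z
    simp only [Fintype.sum_prod_type]
    refine Finset.sum_nonneg fun x _ => ?_
    rw [Finset.sum_comm]
    refine Finset.sum_nonneg fun y _ => ?_
    by_cases hxy : x = y
    · subst hxy
      simp [hdiag]
    · have := mul_nonneg (mul_nonneg (mul_nonneg hα.le (hp0 x z)) (hp0 y z))
        (hoff x y (r x z) (r y z))
      refine this.trans (le_of_eq ?_)
      simp only [hxy, if_false, zero_add, Finset.mul_sum]
      exact Finset.sum_congr rfl fun k _ => Finset.sum_congr rfl fun l _ => by
        simp only [Finset.mul_sum, Finset.sum_mul]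
        exact Finset.sum_congr rfl fun i _ => by ring

theorem measurePreserving_comp_stdGaussianPi {ι κ : Type*} [Fintype ι] [Fintype κ] {e : κ → ι}
    (he : Function.Injective e) :
    MeasurePreserving (fun ω : ι → ℝ => fun k => ω (e k)) (stdGaussianPi ι) (stdGaussianPi κ) := by
  refine ⟨by fun_prop, ?_⟩
  have h : iIndepFun (fun i (ω : ι → ℝ) => ω i) (stdGaussianPi ι) :=
    iIndepFun_pi (X := fun _ => id) fun _ => aemeasurable_id
  have h2 := (iIndepFun_iff_map_fun_eq_pi_map
    (fun i => (measurable_pi_apply (e i)).aemeasurable)).1 (h.precomp he)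
  rw [h2]
  congr 1
  ext1 k
  exact (measurePreserving_eval (fun _ : ι => gaussianReal 0 1) (e k)).map_eq

theorem measurePreserving_gaussianMatrixMeasure {ι : Type*} [Fintype ι] {n N : ℕ}
    {e : Fin n × Fin N → ι} (he : Function.Injective e) :
    MeasurePreserving (fun ω : ι → ℝ => fun i j => ω (e (i, j))) (stdGaussianPi ι)
      (gaussianMatrixMeasure n N) := by
  have h : MeasurePreserving (MeasurableEquiv.curry (Fin n) (Fin N) ℝ)
      (stdGaussianPi (Fin n × Fin N)) (gaussianMatrixMeasure n N) := by
    refine ⟨(MeasurableEquiv.curry _ _ _).measurable, ?_⟩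
    have := Measure.infinitePi_map_curry (fun (_ : Fin n) (_ : Fin N) => gaussianReal 0 1)
    simp only [Measure.infinitePi_eq_pi] at this
    exact this
  exact h.comp (measurePreserving_comp_stdGaussianPi he)

theorem hasFDerivAt_sqrt_add_sum_sq {κ : Type*} [Fintype κ] {ε : ℝ} (hε : 0 < ε)
    (z : Option κ → ℝ) :
    HasFDerivAt (fun z : Option κ → ℝ => √(ε ^ 2 + ∑ k, z (some k) ^ 2))
      (∑ k, (z (some k) / √(ε ^ 2 + ∑ k, z (some k) ^ 2)) •
        ContinuousLinearMap.proj (R := ℝ) (φ := fun _ => ℝ) (some k)) z := by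
  have hpos : 0 < ε ^ 2 + ∑ k, z (some k) ^ 2 := by positivity
  have h1 : HasFDerivAt (fun z : Option κ → ℝ => ε ^ 2 + ∑ k, z (some k) ^ 2)
      (∑ k, (2 * z (some k)) •
        ContinuousLinearMap.proj (R := ℝ) (φ := fun _ : Option κ => ℝ) (some k)) z := by
    refine (HasFDerivAt.fun_sum fun k _ => ?_).const_add _
    have := (ContinuousLinearMap.proj (R := ℝ) (φ := fun _ : Option κ => ℝ)
      (some k)).hasFDerivAt (x := z) |>.pow 2
    convert! this using 1
    simp
  convert! h1.sqrt hpos.ne' using 1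
  ext v
  simp only [sum_apply, smul_apply, smul_eq_mul, Finset.mul_sum, ContinuousLinearMap.proj_apply]
  refine Finset.sum_congr rfl fun k _ => ?_
  have := (Real.sqrt_pos.2 hpos).ne'
  field_simp

theorem integral_softmin_gordon {S : Type*} [Fintype S] [Nonempty S] {n N : ℕ} {α ε : ℝ}
    (hα : 0 < α) (hε : 0 < ε) (u : S → Fin N → ℝ) (hu : ∀ x, ∑ j, u x j ^ 2 = 1) :
    ∫ ω, softmin α (fun x => √(ε ^ 2 + ∑ k : Fin n, ω (some k, none) ^ 2) +
        ∑ j, u x j * ω (none, some j)) ∂stdGaussianPi (Option (Fin n) × Option (Fin N)) ≤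
      ∫ ω, softmin α (fun x => √(ε ^ 2 + ∑ k : Fin n, (∑ j, u x j * ω (some k, some j)) ^ 2) +
        ω (none, none)) ∂stdGaussianPi (Option (Fin n) × Option (Fin N)) := by
  let q : (Option (Fin n) → ℝ) → ℝ := fun z => √(ε ^ 2 + ∑ k, z (some k) ^ 2)
  have hq2 : ∀ z, q z ^ 2 = ε ^ 2 + ∑ k, z (some k) ^ 2 := fun z => Real.sq_sqrt (by positivity)
  have hqε : ∀ z, ε ≤ q z := fun z => Real.le_sqrt_of_sq_le (by
    have : 0 ≤ ∑ k, z (some k) ^ 2 := by positivity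
    linarith)
  have hq : ∀ z, 0 < q z := fun z => hε.trans_le (hqε z)
  have hzq : ∀ k z, |z (some k)| ≤ q z := fun k z => Real.abs_le_sqrt (by
    have : z (some k) ^ 2 ≤ ∑ k, z (some k) ^ 2 :=
      Finset.single_le_sum (f := fun k => z (some k) ^ 2) (fun _ _ => sq_nonneg _)
        (Finset.mem_univ k)
    have h2 := sq_nonneg ε
    linarith)
  let dm : Option (Fin n) → (Option (Fin n) → ℝ) → ℝ := fun k z =>
    k.elim 1 fun i => z (some i) / q z
  let ddm : Option (Fin n) → Option (Fin n) → (Option (Fin n) → ℝ) → ℝ := fun k l z =>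
    k.elim 0 fun i => l.elim 0 fun j =>
      (if i = j then (q z)⁻¹ else 0) - z (some i) / q z * (z (some j) / q z) * (q z)⁻¹
  have hqd : ∀ z, HasFDerivAt q (∑ k, (z (some k) / q z) •
      ContinuousLinearMap.proj (R := ℝ) (φ := fun _ => ℝ) (some k)) z :=
    hasFDerivAt_sqrt_add_sum_sq hε
  have hqc : Continuous q := continuous_iff_continuousAt.2 fun z => (hqd z).continuousAt
  have hle1 : ∀ k z, |z (some k) / q z| ≤ 1 := fun k z => by
    rw [abs_div, abs_of_pos (hq z)]
    exact (div_le_one (hq z)).2 (hzq k z)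
  let lrow : S → Option (Fin n) → Option (Fin N) → ℝ := fun x k b =>
    k.elim (b.elim 1 fun _ => 0) fun _ => b.elim 0 fun j => u x j
  let krow : S → Option (Fin n) → Option (Fin N) → ℝ := fun x k b =>
    k.elim (b.elim 0 fun j => u x j) fun _ => b.elim 1 fun _ => 0
  have huv : ∀ x y, ∑ j, u x j * u y j ≤ 1 := by
    intro x y
    have : ∑ j, u x j * u y j ≤ ∑ j, (u x j ^ 2 + u y j ^ 2) / 2 :=
      Finset.sum_le_sum fun j _ => by nlinarith [sq_nonneg (u x j - u y j)]
    rw [← Finset.sum_div, Finset.sum_add_distrib, hu, hu] at this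
    linarith
  have hcov : ∀ x y k l, ∑ i : Option (Fin n) × Option (Fin N),
      ((if k = i.1 then lrow x k i.2 else 0) * (if l = i.1 then lrow y l i.2 else 0) -
        (if k = i.1 then krow x k i.2 else 0) * (if l = i.1 then krow y l i.2 else 0)) =
      if k = l then k.elim (1 - ∑ j, u x j * u y j) (fun _ => ∑ j, u x j * u y j - 1) else 0 := by
    intro x y k l
    rw [Fintype.sum_prod_type]
    by_cases hkl : k = l
    · subst hkl
      rw [Finset.sum_eq_single k]
      · cases k <;> simp [lrow, krow, Fintype.sum_option]
      · intro b _ hb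
        simp [hb.symm]
      · simp
    · rw [if_neg hkl]
      refine Finset.sum_eq_zero fun a _ => Finset.sum_eq_zero fun b _ => ?_
      by_cases h1 : k = a
      · have : l ≠ a := fun h => hkl (h1.trans h.symm)
        simp [this]
      · simp [h1]
  have key := integral_softmin_comp_linear_le (D := 2 * ε⁻¹) hα
    (fun (a : S × Option (Fin n)) (i : Option (Fin n) × Option (Fin N)) =>
      if a.2 = i.1 then lrow a.1 a.2 i.2 else 0)
    (fun (a : S × Option (Fin n)) (i : Option (Fin n) × Option (Fin N)) =>
      if a.2 = i.1 then krow a.1 a.2 i.2 else 0)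
    (m := fun z => q z + z none) (dm := dm) (ddm := ddm) ?_ ?_ ?_ ?_ ?_ ?_ ?_ ?_
  · convert! key using 1
    · congr 1; ext ω; congr 1; ext x
      simp [q, krow, Fintype.sum_prod_type, Fintype.sum_option, ite_mul]
    · congr 1; ext ω; congr 1; ext x
      simp [q, lrow, Fintype.sum_prod_type, Fintype.sum_option, ite_mul]
  · rintro ⟨x, k⟩ ⟨y, l⟩
    refine Finset.sum_eq_zero fun i _ => ?_
    rcases i with ⟨a, b⟩
    dsimp only
    by_cases h1 : k = a
    · by_cases h2 : l = a
      · subst h1 h2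
        cases l <;> cases b <;> simp [lrow, krow]
      · simp [h2]
    · simp [h1]
  · intro z
    convert! (hqd z).add (ContinuousLinearMap.proj (R := ℝ)
      (φ := fun _ : Option (Fin n) => ℝ) none).hasFDerivAt using 1
    ext v
    simp [Fintype.sum_option, dm, add_comm]
  · intro k z
    cases k with
    | none =>
      refine (hasFDerivAt_const (1 : ℝ) z).congr_fderiv ?_
      ext v
      simp [ddm]
    | some i =>
      have h := ((ContinuousLinearMap.proj (R := ℝ) (φ := fun _ : Option (Fin n) => ℝ)
        (some i)).hasFDerivAt (x := z)).mul
          ((hasDerivAt_inv (hq z).ne').comp_hasFDerivAt z (hqd z))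
      convert! h using 1
      ext v
      have := (hq z).ne'
      simp only [ddm, Fintype.sum_option, Option.elim, sub_mul, Finset.sum_sub_distrib, ite_mul,
        zero_mul, zero_smul, add_apply, sum_apply, smul_apply, smul_eq_mul,
        ContinuousLinearMap.proj_apply, Finset.sum_ite_eq, Finset.mem_univ, if_true,
        Function.comp, Finset.mul_sum, zero_add]
      rw [sub_eq_add_neg, add_comm, ← Finset.sum_neg_distrib]
      congr 1
      · refine Finset.sum_congr rfl fun k _ => ?_
        field_simp
  · intro k l
    have := hqc.measurable
    cases k <;> cases l <;> simp only [ddm, Option.elim]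
    case some.some i j =>
      refine Measurable.sub ?_ (by fun_prop)
      split_ifs <;> fun_prop
    all_goals exact measurable_const
  · intro k z
    cases k with
    | none => simp [dm]
    | some i => exact hle1 i z
  · intro k l z
    cases k with
    | none => simp [ddm, hε.le]
    | some i =>
      cases l with
      | none => simp [ddm, hε.le]
      | some j =>
        have h0 : 0 < (q z)⁻¹ := inv_pos.2 (hq z)
        have h1 : (q z)⁻¹ ≤ ε⁻¹ := inv_anti₀ hε (hqε z)
        have h2 : |z (some i) / q z * (z (some j) / q z) * (q z)⁻¹| ≤ ε⁻¹ := by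
          rw [abs_mul, abs_mul, abs_of_pos h0]
          exact (mul_le_of_le_one_left h0.le
            (mul_le_one₀ (hle1 i z) (abs_nonneg _) (hle1 j z))).trans h1
        have h3 : |if i = j then (q z)⁻¹ else 0| ≤ ε⁻¹ := by
          split_ifs
          · rwa [abs_of_pos h0]
          · simpa using hε.le
        refine (abs_sub _ _).trans ?_
        linarith
  · intro x k l
    refine (hcov x x k l).trans ?_
    have : ∑ j, u x j * u x j = 1 := by simpa [sq] using hu x
    cases k <;> simp [this]
  · intro x y z w
    have hsum : ∑ k, z (some k) / q z * (w (some k) / q w) ≤ 1 := by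
      have h1 : ∀ z, ∑ k, (z (some k) / q z) ^ 2 ≤ 1 := by
        intro z
        simp only [div_pow]
        rw [← Finset.sum_div, div_le_one (pow_pos (hq z) 2), hq2]
        have := sq_nonneg ε
        linarith
      have : ∑ k, z (some k) / q z * (w (some k) / q w) ≤
          ∑ k, ((z (some k) / q z) ^ 2 + (w (some k) / q w) ^ 2) / 2 :=
        Finset.sum_le_sum fun k _ => by
          nlinarith [sq_nonneg (z (some k) / q z - w (some k) / q w)]
      rw [← Finset.sum_div, Finset.sum_add_distrib] at this
      linarith [h1 z, h1 w]
    have e : ∀ k l, (∑ i : Option (Fin n) × Option (Fin N),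
      ((if k = i.1 then lrow x k i.2 else 0) * (if l = i.1 then lrow y l i.2 else 0) -
        (if k = i.1 then krow x k i.2 else 0) * (if l = i.1 then krow y l i.2 else 0))) *
        (dm k z * dm l w) = if k = l then
          k.elim (1 - ∑ j, u x j * u y j) (fun _ => ∑ j, u x j * u y j - 1) *
            (dm k z * dm l w) else 0 := by
      intro k l
      rw [hcov, ite_mul, zero_mul]
    refine (mul_nonneg (sub_nonneg.2 (huv x y)) (sub_nonneg.2 hsum)).trans (le_of_eq ?_)
    simp only [e, Finset.sum_ite_eq, Finset.mem_univ, if_true]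
    rw [Fintype.sum_option]
    simp only [Option.elim, dm, ← Finset.mul_sum]
    ring

theorem integrable_pow_gaussianReal (p : ℕ) : Integrable (fun x => x ^ p) (gaussianReal 0 1) := by
  by_cases hp : p = 0
  · simp [hp]
  · have h := (memLp_id_gaussianReal (μ := 0) (v := 1) p).integrable_norm_pow (by exact_mod_cast hp)
    refine (integrable_norm_iff (by fun_prop)).1 (h.congr (ae_of_all _ fun x => ?_))
    simp

theorem integral_sq_gaussianReal : ∫ x, x ^ 2 ∂gaussianReal 0 1 = 1 := by
  have h := variance_fun_id_gaussianReal (μ := 0) (v := 1)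
  rw [variance_eq_integral (by fun_prop)] at h
  simpa [integral_id_gaussianReal] using h

theorem integrable_sq_eval_stdGaussianPi {ι : Type*} [Fintype ι] (i : ι) :
    Integrable (fun ω : ι → ℝ => ω i ^ 2) (stdGaussianPi ι) :=
  (measurePreserving_eval (fun _ : ι => gaussianReal 0 1) i).integrable_comp_of_integrable
    (integrable_pow_gaussianReal 2)

theorem Real.sqrt_le_one_add {y : ℝ} (hy : 0 ≤ y) : √y ≤ 1 + y :=
  Real.sqrt_le_iff.2 ⟨by linarith, by nlinarith⟩

theorem MeasureTheory.Integrable.sqrt {α : Type*} [MeasurableSpace α] {μ : Measure α}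
    [IsFiniteMeasure μ] {f : α → ℝ} (hf : Integrable f μ) (h0 : ∀ x, 0 ≤ f x) :
    Integrable (fun x => √(f x)) μ := by
  refine ((integrable_const 1).add hf).mono'
    (Real.continuous_sqrt.comp_aestronglyMeasurable hf.aestronglyMeasurable)
    (ae_of_all _ fun x => ?_)
  rw [Real.norm_of_nonneg (Real.sqrt_nonneg _)]
  exact Real.sqrt_le_one_add (h0 x)

theorem MeasureTheory.integral_sqrt_le_sqrt_integral {α : Type*} [MeasurableSpace α]
    {μ : Measure α} [IsProbabilityMeasure μ] {f : α → ℝ} (hf : Integrable f μ)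
    (h0 : ∀ x, 0 ≤ f x) : ∫ x, √(f x) ∂μ ≤ √(∫ x, f x ∂μ) := by
  have h := variance_nonneg (fun x => √(f x)) μ
  have hm : MemLp (fun x => √(f x)) 2 μ := by
    refine (memLp_two_iff_integrable_sq (hf.sqrt h0).aestronglyMeasurable).2 ?_
    simpa [Real.sq_sqrt (h0 _)] using hf
  rw [variance_eq_sub hm] at h
  refine Real.le_sqrt_of_sq_le ?_
  have : ∫ x, ((fun x => √(f x)) ^ 2) x ∂μ = ∫ x, f x ∂μ := by
    congr 1; ext x; simp [Real.sq_sqrt (h0 x)]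
  linarith

theorem gordon_min_norm_lower_bound {S : Type*} [Fintype S] [Nonempty S] {n N : ℕ}
    (u : S → Fin N → ℝ) (hu : ∀ x, ∑ j, u x j ^ 2 = 1)
    {R : (Fin N → ℝ) → ℝ} {Q : (Fin n → Fin N → ℝ) → ℝ}
    (hR : Integrable R (stdGaussianPi (Fin N))) (hQ : Integrable Q (gaussianMatrixMeasure n N))
    (hRu : ∀ x h, -R h ≤ ∑ j, u x j * h j)
    (hQu : ∀ A c, (∀ x, c ≤ √(normSqMulVec A (u x))) → c ≤ Q A) :
    ∫ g, √(∑ k, g k ^ 2) ∂stdGaussianPi (Fin n) - ∫ h, R h ∂stdGaussianPi (Fin N) ≤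
      ∫ A, Q A ∂gaussianMatrixMeasure n N := by
  set Ω := Option (Fin n) × Option (Fin N)
  have hg := measurePreserving_comp_stdGaussianPi (ι := Ω) (κ := Fin n)
    (e := fun k => (some k, none)) (fun _ _ h => Option.some.inj (Prod.ext_iff.1 h).1)
  have hh := measurePreserving_comp_stdGaussianPi (ι := Ω) (κ := Fin N)
    (e := fun k => (none, some k)) (fun _ _ h => Option.some.inj (Prod.ext_iff.1 h).2)
  have hA := measurePreserving_gaussianMatrixMeasure (ι := Ω) (n := n) (N := N)
    (e := fun p => (some p.1, some p.2)) (fun _ _ h =>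
      Prod.ext (Option.some.inj (Prod.ext_iff.1 h).1) (Option.some.inj (Prod.ext_iff.1 h).2))
  have hgi : Integrable (fun g : Fin n → ℝ => √(∑ k, g k ^ 2)) (stdGaussianPi (Fin n)) :=
    (integrable_finsetSum _ fun k _ => integrable_sq_eval_stdGaussianPi k).sqrt
      fun _ => by positivity
  have eg := hg.integral_comp_of_aestronglyMeasurable hgi.aestronglyMeasurable
  have eR := hh.integral_comp_of_aestronglyMeasurable hR.aestronglyMeasurable
  have eQ := hA.integral_comp_of_aestronglyMeasurable hQ.aestronglyMeasurable
  have hgΩ := hg.integrable_comp_of_integrable hgi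
  have hRΩ := hh.integrable_comp_of_integrable hR
  have hQΩ := hA.integrable_comp_of_integrable hQ
  have hγΩ := integrable_eval_stdGaussianPi (ι := Ω) (none, none)
  have hsm : ∀ (α : ℝ) (f : S → (Ω → ℝ) → ℝ), (∀ x, Continuous (f x)) →
      AEStronglyMeasurable (fun ω => softmin α fun x => f x ω) (stdGaussianPi Ω) := by
    intro α f hf
    have h2 : Continuous fun ω => softmin α fun x => f x ω := by
      unfold softmin
      refine continuous_const.mul (Continuous.log (by fun_prop) fun ω => ?_)
      exact (Finset.sum_pos (fun _ _ => Real.exp_pos _) Finset.univ_nonempty).ne'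
    exact h2.aestronglyMeasurable
  have hcard : 0 ≤ Real.log (Fintype.card S) := Real.log_natCast_nonneg _
  have main : ∀ α ε : ℝ, 0 < α → 0 < ε →
      ∫ g, √(∑ k, g k ^ 2) ∂stdGaussianPi (Fin n) - ∫ h, R h ∂stdGaussianPi (Fin N)
        - Real.log (Fintype.card S) / α ≤ ε + ∫ A, Q A ∂gaussianMatrixMeasure n N := by
    intro α ε hα hε
    have hsq : ∀ y : ℝ, 0 ≤ y → √y ≤ √(ε ^ 2 + y) ∧ √(ε ^ 2 + y) ≤ ε + √y := by
      intro y hy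
      refine ⟨Real.sqrt_le_sqrt (by nlinarith), Real.sqrt_le_iff.2 ⟨by positivity, ?_⟩⟩
      nlinarith [Real.sq_sqrt hy, Real.sqrt_nonneg y]
    obtain ⟨x0⟩ := ‹Nonempty S›
    have : Nonempty S := ⟨x0⟩
    have lo1 : ∀ ω : Ω → ℝ, √(∑ k : Fin n, ω (some k, none) ^ 2) - R (fun j => ω (none, some j))
        - Real.log (Fintype.card S) / α ≤
        softmin α (fun x => √(ε ^ 2 + ∑ k : Fin n, ω (some k, none) ^ 2) +
          ∑ j, u x j * ω (none, some j)) := fun ω => le_softmin hα _ fun x => by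
      have := (hsq (∑ k : Fin n, ω (some k, none) ^ 2) (by positivity)).1
      linarith [hRu x fun j => ω (none, some j)]
    have hi1 : ∀ ω : Ω → ℝ, softmin α (fun x => √(ε ^ 2 + ∑ k : Fin n, ω (some k, none) ^ 2) +
          ∑ j, u x j * ω (none, some j)) ≤
        ε + √(∑ k : Fin n, ω (some k, none) ^ 2) + ∑ j, u x0 j * ω (none, some j) := fun ω => by
      refine (softmin_le hα _ x0).trans ?_
      have := (hsq (∑ k : Fin n, ω (some k, none) ^ 2) (by positivity)).2
      linarith
    have lo2 : ∀ ω : Ω → ℝ, ω (none, none) - Real.log (Fintype.card S) / α ≤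
        softmin α (fun x => √(ε ^ 2 + ∑ k : Fin n, (∑ j, u x j * ω (some k, some j)) ^ 2) +
          ω (none, none)) := fun ω => le_softmin hα _ fun x => by
      linarith [Real.sqrt_nonneg (ε ^ 2 + ∑ k : Fin n, (∑ j, u x j * ω (some k, some j)) ^ 2)]
    have hi2 : ∀ ω : Ω → ℝ,
        softmin α (fun x => √(ε ^ 2 + ∑ k : Fin n, (∑ j, u x j * ω (some k, some j)) ^ 2) +
          ω (none, none)) ≤ ε + ω (none, none) + Q (fun i j => ω (some i, some j)) := fun ω => by
      rw [← sub_le_iff_le_add']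
      refine hQu _ _ fun x => ?_
      have h1 := softmin_le hα (fun x => √(ε ^ 2 + ∑ k : Fin n,
        (∑ j, u x j * ω (some k, some j)) ^ 2) + ω (none, none)) x
      have h2 := (hsq (∑ k : Fin n, (∑ j, u x j * ω (some k, some j)) ^ 2) (by positivity)).2
      have h3 : normSqMulVec (fun i j => ω (some i, some j)) (u x) =
          ∑ k : Fin n, (∑ j, u x j * ω (some k, some j)) ^ 2 := by
        simp only [normSqMulVec, mul_comm]
      rw [h3]
      linarith
    have ilo1 := (hgΩ.sub hRΩ).sub
      (integrable_const (μ := stdGaussianPi Ω) (Real.log (Fintype.card S) / α))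
    have ihi1 := ((integrable_const (μ := stdGaussianPi Ω) ε).add hgΩ).add
      (integrable_finsetSum Finset.univ fun (j : Fin N) _ =>
        (integrable_eval_stdGaussianPi (ι := Ω) (none, some j)).const_mul (u x0 j))
    have ilo2 := hγΩ.sub
      (integrable_const (μ := stdGaussianPi Ω) (Real.log (Fintype.card S) / α))
    have ihi2 := ((integrable_const (μ := stdGaussianPi Ω) ε).add hγΩ).add hQΩ
    have i1 := integrable_of_le_of_le (hsm α _ fun x => by fun_prop)
      (ae_of_all _ lo1) (ae_of_all _ hi1) ilo1 ihi1
    have i2 := integrable_of_le_of_le (hsm α _ fun x => by fun_prop)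
      (ae_of_all _ lo2) (ae_of_all _ hi2) ilo2 ihi2
    have e1 := integral_mono ilo1 i1 lo1
    have e2 := integral_mono i2 ihi2 hi2
    have e3 := integral_softmin_gordon hα hε u hu (n := n)
    rw [integral_sub' (hgΩ.sub hRΩ) (integrable_const _), integral_sub' hgΩ hRΩ, integral_const] at e1
    rw [integral_add' ((integrable_const _).add hγΩ) hQΩ, integral_add' (integrable_const _) hγΩ,
      integral_const, integral_eval_stdGaussianPi] at e2
    simp only [probReal_univ, one_smul, Function.comp_def] at e1 e2
    linarith
  refine le_of_forall_pos_le_add fun η hη => ?_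
  have h := main ((Real.log (Fintype.card S) + 1) / (η)) (η / (Real.log (Fintype.card S) + 1))
    (by positivity) (by positivity)
  have h2 : Real.log (Fintype.card S) / ((Real.log (Fintype.card S) + 1) / η) +
      η / (Real.log (Fintype.card S) + 1) = η := by field_simp
  linarith

theorem sqrt_sub_le_integral_sqrt_sum_sq {n : ℕ} (hn : 0 < n) :
    √n - Var[fun x => x ^ 2; gaussianReal 0 1] / (2 * √n) ≤
      ∫ g, √(∑ k, g k ^ 2) ∂stdGaussianPi (Fin n) := by
  have hr : 0 < √(n : ℝ) := Real.sqrt_pos.2 (by exact_mod_cast hn)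
  have hr2 : √(n : ℝ) ^ 2 = n := Real.sq_sqrt (by positivity)
  set r := √(n : ℝ)
  have hwi : Integrable (fun g : Fin n → ℝ => ∑ k, g k ^ 2) (stdGaussianPi (Fin n)) :=
    integrable_finsetSum _ fun k _ => integrable_sq_eval_stdGaussianPi k
  have hw : ∫ g : Fin n → ℝ, ∑ k, g k ^ 2 ∂stdGaussianPi (Fin n) = n := by
    rw [integral_finsetSum _ fun k _ => integrable_sq_eval_stdGaussianPi k]
    have : ∀ k : Fin n, ∫ g : Fin n → ℝ, g k ^ 2 ∂stdGaussianPi (Fin n) = 1 := fun k =>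
      ((measurePreserving_eval (fun _ : Fin n => gaussianReal 0 1)
        k).integral_comp_of_aestronglyMeasurable (g := fun x => x ^ 2) (by fun_prop)).trans
        integral_sq_gaussianReal
    simp [this]
  have hL2 : MemLp (fun x : ℝ => x ^ 2) 2 (gaussianReal 0 1) := by
    refine (memLp_two_iff_integrable_sq (by fun_prop)).2 ?_
    simpa [← pow_mul] using integrable_pow_gaussianReal 4
  have hfun : (∑ k, fun g : Fin n → ℝ => g k ^ 2) = fun g => ∑ k, g k ^ 2 := by
    ext g; simp
  have hvar := variance_sum_pi (μ := fun _ : Fin n => gaussianReal 0 1)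
    (X := fun _ x => x ^ 2) fun _ => hL2
  have hwL2 : MemLp (fun g : Fin n → ℝ => ∑ k, g k ^ 2) 2 (stdGaussianPi (Fin n)) :=
    memLp_finsetSum _ fun k _ =>
      hL2.comp_measurePreserving (measurePreserving_eval (fun _ : Fin n => gaussianReal 0 1) k)
  rw [hfun, variance_eq_integral hwL2.aestronglyMeasurable.aemeasurable, hw] at hvar
  simp only [Finset.sum_const, Finset.card_univ, Fintype.card_fin, nsmul_eq_mul] at hvar
  have hsqi : Integrable (fun g : Fin n → ℝ => (∑ k, g k ^ 2 - n) ^ 2) (stdGaussianPi (Fin n)) :=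
    (hwL2.sub (memLp_const _)).integrable_sq
  have hpt : ∀ g : Fin n → ℝ, (r / 2 + (2 * r)⁻¹ * ∑ k, g k ^ 2) -
      (2 * r ^ 3)⁻¹ * (∑ k, g k ^ 2 - n) ^ 2 ≤ √(∑ k, g k ^ 2) := by
    intro g
    have hw0 : 0 ≤ ∑ k, g k ^ 2 := by positivity
    set y := √(∑ k, g k ^ 2) with hy
    have hy0 : 0 ≤ y := Real.sqrt_nonneg _
    rw [← Real.sq_sqrt hw0, ← hy, ← hr2]
    have : y - ((r / 2 + (2 * r)⁻¹ * y ^ 2) - (2 * r ^ 3)⁻¹ * (y ^ 2 - r ^ 2) ^ 2) =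
        (2 * r ^ 3)⁻¹ * ((y - r) ^ 2 * (y * (y + 2 * r))) := by
      field_simp
      ring
    have h2 : 0 ≤ (2 * r ^ 3)⁻¹ * ((y - r) ^ 2 * (y * (y + 2 * r))) := by positivity
    linarith
  have hlin : Integrable (fun g : Fin n → ℝ => r / 2 + (2 * r)⁻¹ * ∑ k, g k ^ 2)
      (stdGaussianPi (Fin n)) := (integrable_const _).add (hwi.const_mul _)
  have hint := integral_mono (hlin.sub (hsqi.const_mul ((2 * r ^ 3)⁻¹)))
    (hwi.sqrt fun _ => by positivity) hpt
  rw [integral_sub' hlin (hsqi.const_mul _), integral_const_mul, hvar,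
    integral_add (integrable_const _) (hwi.const_mul _), integral_const_mul, hw, integral_const,
    ← hr2] at hint
  refine le_trans (le_of_eq ?_) hint
  simp only [probReal_univ, one_smul]
  field_simp
  ring

theorem sparseUnitVecs_nonempty {N s : ℕ} (hN : 0 < N) (hs : 0 < s) :
    (sparseUnitVecs N s).Nonempty := by
  refine ⟨Pi.single ⟨0, hN⟩ 1, ?_, ?_⟩
  · rw [Finset.sum_eq_single ⟨0, hN⟩] <;> simp +contextual
  · refine le_trans (Finset.card_le_one.2 ?_) hs
    simp +contextual [Pi.single_apply]

theorem sigmaMin_nonneg {n N : ℕ} (s : ℕ) (A : Fin n → Fin N → ℝ) : 0 ≤ sigmaMin n N s A := by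
  refine Real.sInf_nonneg ?_
  rintro _ ⟨x, -, rfl⟩
  exact Real.sqrt_nonneg _

theorem sigmaMin_le {n N s : ℕ} (A : Fin n → Fin N → ℝ) {x : Fin N → ℝ}
    (hx : x ∈ sparseUnitVecs N s) : sigmaMin n N s A ≤ √(normSqMulVec A x) := by
  refine csInf_le ⟨0, ?_⟩ ⟨x, hx, rfl⟩
  rintro _ ⟨x, -, rfl⟩
  exact Real.sqrt_nonneg _

theorem sqrt_normSqMulVec_le {n N : ℕ} (A : Fin n → Fin N → ℝ) (x : Fin N → ℝ) :
    √(normSqMulVec A x) ≤ √(∑ i, ∑ j, A i j ^ 2) * √(∑ j, x j ^ 2) := by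
  rw [← Real.sqrt_mul (by positivity)]
  refine Real.sqrt_le_sqrt ?_
  rw [normSqMulVec, Finset.sum_mul]
  exact Finset.sum_le_sum fun i _ => Finset.sum_mul_sq_le_sq_mul_sq _ _ _

theorem sqrt_normSqMulVec_le_add {n N : ℕ} (A : Fin n → Fin N → ℝ) (x y : Fin N → ℝ) :
    √(normSqMulVec A x) ≤ √(normSqMulVec A y) + √(normSqMulVec A (x - y)) := by
  have h : ∀ z, √(normSqMulVec A z) = ‖WithLp.toLp 2 fun i => ∑ j, A i j * z j‖ := fun z => by
    simp [EuclideanSpace.norm_eq, normSqMulVec]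
  rw [h, h, h]
  refine le_trans (le_of_eq ?_) (norm_add_le _ _)
  congr 1
  ext i
  simp [mul_sub]

theorem continuous_sqrt_normSqMulVec {n N : ℕ} (x : Fin N → ℝ) :
    Continuous fun A : Fin n → Fin N → ℝ => √(normSqMulVec A x) := by
  unfold normSqMulVec
  fun_prop

instance isProbabilityMeasure_gaussianMatrixMeasure (n N : ℕ) :
    IsProbabilityMeasure (gaussianMatrixMeasure n N) := by
  unfold gaussianMatrixMeasure
  infer_instance

theorem integrable_frobenius_gaussianMatrixMeasure (n N : ℕ) :
    Integrable (fun A : Fin n → Fin N → ℝ => √(∑ i, ∑ j, A i j ^ 2))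
      (gaussianMatrixMeasure n N) := by
  refine Integrable.sqrt (integrable_finsetSum _ fun i _ => ?_) fun _ => by positivity
  exact (measurePreserving_eval (fun _ : Fin n => stdGaussianPi (Fin N))
    i).integrable_comp_of_integrable
    (integrable_finsetSum _ fun j _ => integrable_sq_eval_stdGaussianPi j)

theorem integrable_sigmaMin {n N s : ℕ} (hN : 0 < N) (hs : 0 < s) :
    Integrable (sigmaMin n N s) (gaussianMatrixMeasure n N) := by
  obtain ⟨x, hx⟩ := sparseUnitVecs_nonempty hN hs
  have hm : Measurable (sigmaMin n N s) := by
    have h : sigmaMin n N s = fun A => ⨅ x : sparseUnitVecs N s, √(normSqMulVec A x) := by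
      ext A
      exact sInf_image'
    have hu : UpperSemicontinuous (sigmaMin n N s) := by
      rw [h]
      refine upperSemicontinuous_ciInf (fun A => ⟨0, ?_⟩) fun x =>
        (continuous_sqrt_normSqMulVec (x : Fin N → ℝ)).upperSemicontinuous
      rintro _ ⟨x, rfl⟩
      exact Real.sqrt_nonneg _
    exact hu.measurable
  refine (integrable_frobenius_gaussianMatrixMeasure n N).mono' hm.aestronglyMeasurable
    (ae_of_all _ fun A => ?_)
  rw [Real.norm_of_nonneg (sigmaMin_nonneg s A)]
  refine (sigmaMin_le A hx).trans ((sqrt_normSqMulVec_le A x).trans_eq ?_)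
  rw [hx.1, Real.sqrt_one, mul_one]

theorem totallyBounded_sparseUnitVecs (N s : ℕ) : TotallyBounded (sparseUnitVecs N s) := by
  refine (isCompact_closedBall (0 : Fin N → ℝ) 1).totallyBounded.subset fun x hx => ?_
  rw [mem_closedBall_zero_iff, pi_norm_le_iff_of_nonneg zero_le_one]
  intro j
  rw [Real.norm_eq_abs, ← sq_le_one_iff_abs_le_one, ← hx.1]
  exact Finset.single_le_sum (f := fun j => x j ^ 2) (fun _ _ => sq_nonneg _) (Finset.mem_univ j)

theorem gordon_sigmaMin_lower_bound {n N s : ℕ} (hN : 0 < N) (hs : 0 < s)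
    {R : (Fin N → ℝ) → ℝ} (hR : Integrable R (stdGaussianPi (Fin N)))
    (hRu : ∀ x ∈ sparseUnitVecs N s, ∀ h, -R h ≤ ∑ j, x j * h j) :
    ∫ g, √(∑ k, g k ^ 2) ∂stdGaussianPi (Fin n) - ∫ h, R h ∂stdGaussianPi (Fin N) ≤
      ∫ A, sigmaMin n N s A ∂gaussianMatrixMeasure n N := by
  have hne := sparseUnitVecs_nonempty hN hs
  have hF := integrable_frobenius_gaussianMatrixMeasure n N
  have hσ := integrable_sigmaMin (n := n) hN hs
  have main : ∀ δ : ℝ, 0 < δ →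
      ∫ g, √(∑ k, g k ^ 2) ∂stdGaussianPi (Fin n) - ∫ h, R h ∂stdGaussianPi (Fin N) ≤
        ∫ A, sigmaMin n N s A ∂gaussianMatrixMeasure n N + δ *
          (√N * ∫ A, √(∑ i, ∑ j, A i j ^ 2) ∂gaussianMatrixMeasure n N) := by
    intro δ hδ
    obtain ⟨S, hSs, hSf, hcov⟩ :=
      Metric.finite_approx_of_totallyBounded (totallyBounded_sparseUnitVecs N s) δ hδ
    have : Fintype S := hSf.fintype
    have : Nonempty S := by
      obtain ⟨x, hx⟩ := hne
      obtain ⟨y, hy, -⟩ := Set.mem_iUnion₂.1 (hcov hx)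
      exact ⟨⟨y, hy⟩⟩
    have h := gordon_min_norm_lower_bound (n := n) (fun x : S => (x : Fin N → ℝ))
      (fun x => (hSs x.2).1) hR (hσ.add (hF.const_mul (δ * √N)))
      (fun x => hRu x (hSs x.2)) (fun A c hc => ?_)
    · rw [integral_add' hσ (hF.const_mul _), integral_const_mul] at h
      linarith
    · change c ≤ sigmaMin n N s A + δ * √N * √(∑ i, ∑ j, A i j ^ 2)
      rw [← sub_le_iff_le_add]
      refine le_csInf (hne.image _) ?_
      rintro _ ⟨x, hx, rfl⟩
      obtain ⟨y, hy, hxy⟩ := Set.mem_iUnion₂.1 (hcov hx)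
      have h1 := hc ⟨y, hy⟩
      have h2 := (sqrt_normSqMulVec_le_add A y x).trans
        (add_le_add_right (sqrt_normSqMulVec_le A (y - x)) _)
      have h3 : √(∑ j, (y - x) j ^ 2) ≤ δ * √N := by
        rw [Real.sqrt_le_left (by positivity), mul_pow, Real.sq_sqrt (by positivity)]
        refine (Finset.sum_le_card_nsmul Finset.univ _ (δ ^ 2) fun j _ => ?_).trans_eq ?_
        · rw [sq_le_sq, abs_of_pos hδ]
          have := (norm_le_pi_norm (y - x) j).trans (mem_ball_iff_norm'.1 hxy).le
          simpa using this
        · simp [mul_comm]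
      have h4 := mul_le_mul_of_nonneg_left h3 (Real.sqrt_nonneg (∑ i, ∑ j, A i j ^ 2))
      simp only at h1 ⊢
      linarith
  set K := √(N : ℝ) * ∫ A, √(∑ i, ∑ j, A i j ^ 2) ∂gaussianMatrixMeasure n N
  have hK : 0 ≤ K := mul_nonneg (Real.sqrt_nonneg _)
    (integral_nonneg fun _ => Real.sqrt_nonneg _)
  refine le_of_forall_pos_le_add fun η hη => (main (η / (K + 1)) (by positivity)).trans ?_
  gcongr
  rw [div_mul_eq_mul_div, div_le_iff₀ (by positivity)]
  nlinarith

theorem measurePreserving_sq_chiSq1 :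
    MeasurePreserving (fun x : ℝ => x ^ 2) (gaussianReal 0 1) chiSq1 :=
  ⟨by fun_prop, rfl⟩

instance isProbabilityMeasure_chiSq1 : IsProbabilityMeasure chiSq1 :=
  Measure.isProbabilityMeasure_map (by fun_prop)

theorem integrable_id_chiSq1 : Integrable (fun y => y) chiSq1 :=
  (measurePreserving_sq_chiSq1.integrable_comp aestronglyMeasurable_id).1
    (integrable_pow_gaussianReal 2)

theorem integral_id_chiSq1 : ∫ y, y ∂chiSq1 = 1 :=
  (measurePreserving_sq_chiSq1.integral_comp_of_aestronglyMeasurable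
    (g := fun y => y) aestronglyMeasurable_id).symm.trans integral_sq_gaussianReal

theorem chiSq1_Ioi_of_neg {t : ℝ} (ht : t < 0) : chiSq1 (Set.Ioi t) = 1 := by
  rw [chiSq1, Measure.map_apply (by fun_prop) measurableSet_Ioi]
  convert measure_univ (μ := gaussianReal 0 1)
  ext x
  simpa using ht.trans_le (sq_nonneg x)

theorem exp_le_chiSq1_real_Ioi {t : ℝ} (ht : 0 ≤ t) :
    Real.exp (-(2 + t)) ≤ chiSq1.real (Set.Ioi t) := by
  have hsub : Set.Ioc √t (√t + 1) ⊆ (fun x : ℝ => x ^ 2) ⁻¹' Set.Ioi t := fun x hx =>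
    (Real.sqrt_lt' ((Real.sqrt_nonneg t).trans_lt hx.1)).1 hx.1
  rw [measureReal_def, chiSq1, Measure.map_apply (by fun_prop) measurableSet_Ioi]
  refine (ENNReal.ofReal_le_iff_le_toReal (measure_ne_top _ _)).1
    (le_trans ?_ (measure_mono hsub))
  rw [gaussianReal_apply _ one_ne_zero]
  have hpdf : ∀ x ∈ Set.Ioc √t (√t + 1),
      ENNReal.ofReal (Real.exp (-(2 + t))) ≤ gaussianPDF 0 1 x := by
    intro x hx
    refine ENNReal.ofReal_le_ofReal ?_
    have hx2 : x ^ 2 ≤ 2 * t + 2 := by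
      have h0 := Real.sqrt_nonneg t
      have h1 : x ^ 2 ≤ (√t + 1) ^ 2 := pow_le_pow_left₀ (h0.trans hx.1.le) hx.2 2
      nlinarith [Real.sq_sqrt ht, sq_nonneg (√t - 1)]
    have hpi : √(2 * Real.pi) ≤ Real.exp 1 := by
      rw [Real.sqrt_le_left (Real.exp_pos 1).le]
      nlinarith [Real.pi_lt_d2, Real.exp_one_gt_d9]
    have hpos : 0 < √(2 * Real.pi) := by positivity
    simp only [gaussianPDFReal, NNReal.coe_one, mul_one, sub_zero]
    calc Real.exp (-(2 + t)) = (Real.exp 1)⁻¹ * Real.exp (-(1 + t)) := by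
          rw [← Real.exp_neg, ← Real.exp_add]; ring_nf
      _ ≤ _ := by gcongr; linarith
  calc ENNReal.ofReal (Real.exp (-(2 + t))) =
      ∫⁻ _ in Set.Ioc √t (√t + 1), ENNReal.ofReal (Real.exp (-(2 + t))) := by simp
    _ ≤ _ := setLIntegral_mono' measurableSet_Ioc hpdf

theorem mul_chiSq1_real_Ioi_le (t : ℝ) :
    t * chiSq1.real (Set.Ioi t) ≤ ∫ y in Set.Ioi t, y ∂chiSq1 := by
  have h := setIntegral_mono_on (μ := chiSq1) (integrable_const t).integrableOn
    integrable_id_chiSq1.integrableOn measurableSet_Ioi (fun y (hy : y ∈ Set.Ioi t) => hy.le)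
  simpa [mul_comm] using h

theorem chiSq1_real_Ioi_le (t : ℝ) :
    chiSq1.real (Set.Ioi t) ≤ ∫ y in Set.Ioi t, y ∂chiSq1 := by
  have h1 := mul_chiSq1_real_Ioi_le t
  rcases le_total 1 t with ht | ht
  · nlinarith [measureReal_nonneg (μ := chiSq1) (s := Set.Ioi t)]
  · have h2 := setIntegral_mono_on (μ := chiSq1) integrable_id_chiSq1.integrableOn
      (integrable_const t).integrableOn measurableSet_Iic (fun y (hy : y ∈ Set.Iic t) => hy)
    have h3 := integral_add_compl (μ := chiSq1) (measurableSet_Ioi (a := t)) integrable_id_chiSq1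
    have h4 := measureReal_add_measureReal_compl (μ := chiSq1) (measurableSet_Ioi (a := t))
    rw [Set.compl_Ioi] at h3 h4
    rw [integral_id_chiSq1] at h3
    rw [probReal_univ] at h4
    simp only [integral_const, smul_eq_mul, MeasurableSet.univ, measureReal_restrict_apply,
      Set.univ_inter] at h2
    nlinarith [measureReal_nonneg (μ := chiSq1) (s := Set.Iic t)]

theorem integrable_max_sub_chiSq1 (t : ℝ) : Integrable (fun y => max (y - t) 0) chiSq1 :=
  (integrable_id_chiSq1.sub (integrable_const t)).pos_part

theorem integral_max_sub_chiSq1 (t : ℝ) :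
    ∫ y, max (y - t) 0 ∂chiSq1 =
      ∫ y in Set.Ioi t, y ∂chiSq1 - t * chiSq1.real (Set.Ioi t) := by
  have h : (fun y => max (y - t) 0) = (Set.Ioi t).indicator fun y => y - t := by
    ext y
    by_cases hy : t < y
    · simp [hy, hy.le]
    · simp [hy, not_lt.1 hy]
  rw [h, integral_indicator measurableSet_Ioi,
    integral_sub integrable_id_chiSq1.integrableOn (integrable_const t).integrableOn]
  simp [mul_comm]

theorem neg_sqrt_le_sum_mul {N s : ℕ} {t : ℝ} (ht : 0 ≤ t) {x : Fin N → ℝ}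
    (hx : x ∈ sparseUnitVecs N s) (h : Fin N → ℝ) :
    -√(s * t + ∑ j, max (h j ^ 2 - t) 0) ≤ ∑ j, x j * h j := by
  refine neg_le_of_abs_le (Real.abs_le_sqrt ?_)
  obtain ⟨hx1, hxs⟩ := hx
  set J := Finset.univ.filter fun j => x j ≠ 0
  have h1 : ∑ j ∈ J, x j * h j = ∑ j, x j * h j := by
    refine Finset.sum_filter_of_ne fun j _ hj => left_ne_zero_of_mul hj
  have h2 : ∑ j ∈ J, x j ^ 2 ≤ 1 := hx1 ▸
    Finset.sum_le_sum_of_subset_of_nonneg (Finset.subset_univ J) fun _ _ _ => sq_nonneg _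
  have h3 : 0 ≤ ∑ j ∈ J, h j ^ 2 := Finset.sum_nonneg fun _ _ => sq_nonneg _
  rw [← h1]
  calc (∑ j ∈ J, x j * h j) ^ 2 ≤ (∑ j ∈ J, x j ^ 2) * ∑ j ∈ J, h j ^ 2 :=
        Finset.sum_mul_sq_le_sq_mul_sq _ _ _
    _ ≤ ∑ j ∈ J, h j ^ 2 := mul_le_of_le_one_left h3 h2
    _ ≤ ∑ j ∈ J, (t + max (h j ^ 2 - t) 0) := Finset.sum_le_sum fun j _ => by
        linarith [le_max_left (h j ^ 2 - t) 0]
    _ = J.card * t + ∑ j ∈ J, max (h j ^ 2 - t) 0 := by simp [Finset.sum_add_distrib]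
    _ ≤ _ := by
        gcongr
        exact Finset.subset_univ J

theorem integral_sqrt_sum_max_le {N s : ℕ} {t : ℝ} (ht : 0 ≤ t) (hN : 0 < N) (hs : 0 < s)
    (hp : chiSq1.real (Set.Ioi t) = s / N) :
    Integrable (fun h : Fin N → ℝ => √(s * t + ∑ j, max (h j ^ 2 - t) 0))
        (stdGaussianPi (Fin N)) ∧
      ∫ h, √(s * t + ∑ j, max (h j ^ 2 - t) 0) ∂stdGaussianPi (Fin N) ≤
        √s * √(condExpGt t) := by
  have hmp : ∀ j : Fin N, MeasurePreserving (fun h : Fin N → ℝ => h j ^ 2)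
      (stdGaussianPi (Fin N)) chiSq1 := fun j =>
    measurePreserving_sq_chiSq1.comp (measurePreserving_eval (fun _ => gaussianReal 0 1) j)
  have hj : ∀ j : Fin N, Integrable (fun h : Fin N → ℝ => max (h j ^ 2 - t) 0)
      (stdGaussianPi (Fin N)) := fun j =>
    (hmp j).integrable_comp_of_integrable (integrable_max_sub_chiSq1 t)
  have hj' : ∀ j : Fin N, ∫ h : Fin N → ℝ, max (h j ^ 2 - t) 0 ∂stdGaussianPi (Fin N) =
      ∫ y, max (y - t) 0 ∂chiSq1 := fun j =>
    (hmp j).integral_comp_of_aestronglyMeasurable (integrable_max_sub_chiSq1 t).aestronglyMeasurable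
  have hi : Integrable (fun h : Fin N → ℝ => s * t + ∑ j, max (h j ^ 2 - t) 0)
      (stdGaussianPi (Fin N)) :=
    (integrable_const _).add (integrable_finsetSum _ fun j _ => hj j)
  refine ⟨hi.sqrt fun _ => by positivity,
    (integral_sqrt_le_sqrt_integral hi fun _ => by positivity).trans_eq ?_⟩
  rw [integral_add (integrable_const _) (integrable_finsetSum _ fun j _ => hj j),
    integral_finsetSum _ fun j _ => hj j, ← Real.sqrt_mul (by positivity)]
  simp only [hj', integral_max_sub_chiSq1, hp, condExpGt, ← measureReal_def]
  congr 1
  simp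
  field_simp
  ring

theorem le_condExpGt {t : ℝ} (hp : 0 < chiSq1.real (Set.Ioi t)) :
    t ≤ condExpGt t ∧ 1 ≤ condExpGt t := by
  rw [condExpGt, ← measureReal_def, le_div_iff₀ hp, le_div_iff₀ hp, one_mul]
  exact ⟨mul_chiSq1_real_Ioi_le t, chiSq1_real_Ioi_le t⟩

/-- **Lower bound on `E σ_min^s(A)`.**  There is a universal constant `C > 0` such that for a
Gaussian `n × N` random matrix `A` and sparsity `s` with `s/N < 1/5`,
`E σ_min^s(A) ≥ √(n − 1/2) − √s·T − C/√(log(N/s))`, where `T = √(E(Y | Y > t))`, `Y ~ χ²₁` and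
`P(Y > t) = s/N`. -/
theorem expectation_sigmaMin_lower_bound :
    ∃ C : ℝ, 0 < C ∧
      ∀ (n N s : ℕ) (t T : ℝ), 0 < s → (s : ℝ) / N < 1 / 5 →
        chiSq1 (Set.Ioi t) = ENNReal.ofReal ((s : ℝ) / N) →
        T = Real.sqrt (condExpGt t) →
        Real.sqrt ((n : ℝ) - 1 / 2) - Real.sqrt s * T - C / Real.sqrt (Real.log ((N : ℝ) / s)) ≤
          ∫ A, sigmaMin n N s A ∂gaussianMatrixMeasure n N := by
  have hv := variance_nonneg (fun x : ℝ => x ^ 2) (gaussianReal 0 1)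
  set v := Var[fun x : ℝ => x ^ 2; gaussianReal 0 1] with hvdef
  refine ⟨v + 1, by positivity, fun n N s t T hs hlt hpt hT => ?_⟩
  have ht : 0 ≤ t := by
    by_contra! h
    rw [chiSq1_Ioi_of_neg h, eq_comm, ENNReal.ofReal_eq_one] at hpt
    linarith
  have hp : chiSq1.real (Set.Ioi t) = s / N := by
    rw [measureReal_def, hpt, ENNReal.toReal_ofReal (by positivity)]
  have htail := exp_le_chiSq1_real_Ioi ht
  rw [hp] at htail
  have hp0 : (0 : ℝ) < s / N := (Real.exp_pos _).trans_le htail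
  have hN : 0 < N := by
    rcases Nat.eq_zero_or_pos N with rfl | h
    · simp at hp0
    · exact h
  obtain ⟨hE1, hE2⟩ := le_condExpGt (t := t) (hp ▸ hp0)
  have hT2 : T ^ 2 = condExpGt t := by rw [hT, Real.sq_sqrt (by linarith)]
  have hT1 : 1 ≤ T := by rw [hT]; exact Real.one_le_sqrt.2 hE2
  have hlog : Real.log (N / s) ≤ 2 + t := by
    have h := (Real.le_log_iff_exp_le hp0).2 htail
    rw [← inv_div, Real.log_inv]
    linarith
  have hlog0 : 0 < Real.log (N / s) := by
    rw [← inv_div, Real.log_inv, neg_pos]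
    exact Real.log_neg hp0 (by linarith)
  set L := √(Real.log ((N : ℝ) / s))
  have hL0 : 0 < L := Real.sqrt_pos.2 hlog0
  have hLT : L ≤ 2 * T := Real.sqrt_le_iff.2 ⟨by positivity, by nlinarith⟩
  have hn1 : √((n : ℝ) - 1 / 2) ≤ √n := Real.sqrt_le_sqrt (by linarith)
  have hCL : 0 ≤ (v + 1) / L := by positivity
  rcases le_or_gt √(n : ℝ) (√s * T) with hsmall | hbig
  · have := integral_nonneg (μ := gaussianMatrixMeasure n N) (f := sigmaMin n N s)
      (sigmaMin_nonneg s)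
    linarith
  have hs1 : 1 ≤ √(s : ℝ) := Real.one_le_sqrt.2 (by exact_mod_cast hs)
  have hTn : T ≤ √n := by nlinarith
  have hn : 0 < n := by
    have : 0 < √(n : ℝ) := by linarith
    exact_mod_cast Real.sqrt_pos.1 this
  obtain ⟨hRi, hRle⟩ := integral_sqrt_sum_max_le ht hN hs hp
  have hgordon := gordon_sigmaMin_lower_bound (n := n) hN hs hRi
    fun x hx h => neg_sqrt_le_sum_mul ht hx h
  have hchi := sqrt_sub_le_integral_sqrt_sum_sq hn
  rw [← hvdef] at hchi
  rw [← hT] at hRle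
  have hvn : v / (2 * √n) ≤ (v + 1) / L := by
    gcongr
    · linarith
    · linarith
  linarith
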